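/- arXiv:2509.17002 — 5 statements merged into one kernel-verified Lean document; each statement's English description precedes it below -/
import Mathlib

section
/- Let k, m, n be positive integers, F a real k×k matrix, G a real k×m matrix, Q a symmetric positive semidefinite real k×k matrix, and R a symmetric positive definite real m×m matrix. Define matrices E_{n+1}, E_n, …, E_1 by the backward recursion E_{n+1} := Q and, for i = n, …, 1, Ψ_{L,i} := R + Gᵀ E_{i+1} G, K_i := Ψ_{L,i}⁻¹ Gᵀ E_{i+1} F, E_i := Fᵀ E_{i+1} F + Q − K_iᵀ Ψ_{L,i} K_i. Then for every initial state x₁ ∈ ℝ^k and every sequence of controls u₁, …, u_n ∈ ℝ^m, the trajectory defined by x_{i+1} := F x_i + G u_i satisfies x_{n+1}ᵀ Q x_{n+1} + Σ_{i=1}^n (x_iᵀ Q x_i + u_iᵀ R u_i) ≥ x₁ᵀ E₁ x₁, with equality if and only if u_i = −K_i x_i for every i = 1, …, n. -/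
open Matrix

/-- A vector can be moved across a dot product by transposing the matrix acting on it. -/
lemma mulVec_dotProduct_eq_dotProduct_transpose_mulVec {ι κ : Type*} [Fintype ι] [Fintype κ]
    (A : Matrix ι κ ℝ) (v : κ → ℝ) (w : ι → ℝ) :
    A *ᵥ v ⬝ᵥ w = v ⬝ᵥ Aᵀ *ᵥ w := by
  rw [dotProduct_mulVec, vecMul_transpose]

section RiccatiStep

variable {ι κ : Type*} [Fintype ι] [Fintype κ]
  {F P Q : Matrix ι ι ℝ} {G : Matrix ι κ ℝ} {R Ψ : Matrix κ κ ℝ} {K : Matrix κ ι ℝ}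

/-- The Riccati update in closed-loop (Joseph) form. -/
lemma riccati_update_eq_closedLoop (hP : Pᵀ = P) (hΨ : Ψ = R + Gᵀ * P * G) (hΨt : Ψᵀ = Ψ)
    (hK : Ψ * K = Gᵀ * P * F) :
    Fᵀ * P * F + Q - Kᵀ * Ψ * K = (F - G * K)ᵀ * P * (F - G * K) + Q + Kᵀ * R * K := by
  have hKt : Kᵀ * Ψ = Fᵀ * P * G := by
    simpa [transpose_mul, hΨt, hP, Matrix.mul_assoc] using congrArg transpose hK
  have hR : R = Ψ - Gᵀ * P * G := by rw [hΨ, add_sub_cancel_right]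
  have hleft : Kᵀ * Gᵀ * P * F = Kᵀ * Ψ * K := by
    rw [Matrix.mul_assoc Kᵀ Ψ K, hK]
    simp only [Matrix.mul_assoc]
  have hright : Fᵀ * P * (G * K) = Kᵀ * Ψ * K := by
    rw [hKt]
    simp only [Matrix.mul_assoc]
  have hquad : Kᵀ * (Gᵀ * P * G) * K = Kᵀ * Gᵀ * P * (G * K) := by
    simp only [Matrix.mul_assoc]
  rw [hR]
  simp only [transpose_sub, transpose_mul, Matrix.sub_mul, Matrix.mul_sub]
  rw [hleft, hright, hquad]
  abel

/-- The Riccati update preserves positive semidefiniteness. -/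
lemma posSemidef_riccati_update (hP : P.PosSemidef) (hQ : Q.PosSemidef) (hR : R.PosSemidef)
    (hΨ : Ψ = R + Gᵀ * P * G) (hΨt : Ψᵀ = Ψ) (hK : Ψ * K = Gᵀ * P * F) :
    (Fᵀ * P * F + Q - Kᵀ * Ψ * K).PosSemidef := by
  rw [riccati_update_eq_closedLoop (by simpa using hP.isHermitian.eq) hΨ hΨt hK]
  have hclosed := hP.conjTranspose_mul_mul_same (F - G * K)
  have hcontrol := hR.conjTranspose_mul_mul_same K
  rw [conjTranspose_eq_transpose_of_trivial] at hclosed hcontrol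
  exact (hclosed.add hQ).add hcontrol

/-- Completion of squares for one step of the linear quadratic regulator. -/
lemma riccati_completion_of_squares (hP : Pᵀ = P) (hΨ : Ψ = R + Gᵀ * P * G) (hΨt : Ψᵀ = Ψ)
    (hK : Ψ * K = Gᵀ * P * F) (x : ι → ℝ) (u : κ → ℝ) :
    (F *ᵥ x + G *ᵥ u) ⬝ᵥ P *ᵥ (F *ᵥ x + G *ᵥ u) + (x ⬝ᵥ Q *ᵥ x + u ⬝ᵥ R *ᵥ u) =
      x ⬝ᵥ (Fᵀ * P * F + Q - Kᵀ * Ψ * K) *ᵥ x + (u + K *ᵥ x) ⬝ᵥ Ψ *ᵥ (u + K *ᵥ x) := by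
  have hKt : Kᵀ * Ψ = Fᵀ * P * G := by
    simpa [transpose_mul, hΨt, hP, Matrix.mul_assoc] using congrArg transpose hK
  have hR : R = Ψ - Gᵀ * P * G := by rw [hΨ, add_sub_cancel_right]
  have hKK : Kᵀ * Gᵀ * P * F = Fᵀ * P * G * K := by
    rw [← hKt, Matrix.mul_assoc Kᵀ Ψ K, hK]
    simp only [Matrix.mul_assoc]
  rw [hR]
  simp only [mulVec_add, add_dotProduct, dotProduct_add, add_mulVec, sub_mulVec, dotProduct_sub,
    mulVec_dotProduct_eq_dotProduct_transpose_mulVec, mulVec_mulVec, ← Matrix.mul_assoc, hK, hKt, hKK]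
  ring

end RiccatiStep

/-- Positive definiteness of the control Hessian. -/
lemma posDef_add_transpose_mul_mul {ι κ : Type*} [Fintype ι] [Fintype κ]
    {P : Matrix ι ι ℝ} {R : Matrix κ κ ℝ} (hP : P.PosSemidef) (hR : R.PosDef)
    (G : Matrix ι κ ℝ) : (R + Gᵀ * P * G).PosDef := by
  have h := hP.conjTranspose_mul_mul_same G
  rw [conjTranspose_eq_transpose_of_trivial] at h
  exact hR.add_posSemidef h

/-- Finite-horizon deterministic LQR optimality: the backward Riccati
recursion gives the optimal cost-to-go `x₁ᵀ E₁ x₁`, and the cost along any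
trajectory `x_{i+1} = F x_i + G u_i` is at least `x₁ᵀ E₁ x₁`, with equality
iff `u_i = −K_i x_i` for all `i = 1, …, n`. -/
theorem stmt2 (k m n : ℕ) (hk : 0 < k) (hm : 0 < m) (hn : 0 < n)
    (F : Matrix (Fin k) (Fin k) ℝ) (G : Matrix (Fin k) (Fin m) ℝ)
    (Q : Matrix (Fin k) (Fin k) ℝ) (R : Matrix (Fin m) (Fin m) ℝ)
    (hQ : Q.PosSemidef) (hR : R.PosDef)
    (E : ℕ → Matrix (Fin k) (Fin k) ℝ)
    (ΨL : ℕ → Matrix (Fin m) (Fin m) ℝ)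
    (K : ℕ → Matrix (Fin m) (Fin k) ℝ)
    (hEend : E (n + 1) = Q)
    (hΨL : ∀ i ∈ Finset.Icc 1 n, ΨL i = R + Gᵀ * E (i + 1) * G)
    (hK : ∀ i ∈ Finset.Icc 1 n, K i = (ΨL i)⁻¹ * (Gᵀ * E (i + 1) * F))
    (hE : ∀ i ∈ Finset.Icc 1 n,
      E i = Fᵀ * E (i + 1) * F + Q - (K i)ᵀ * ΨL i * K i)
    (x : ℕ → Fin k → ℝ) (u : ℕ → Fin m → ℝ)
    (hx : ∀ i ∈ Finset.Icc 1 n, x (i + 1) = F.mulVec (x i) + G.mulVec (u i)) :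
    (x (n + 1) ⬝ᵥ Q.mulVec (x (n + 1))
      + ∑ i ∈ Finset.Icc 1 n, (x i ⬝ᵥ Q.mulVec (x i) + u i ⬝ᵥ R.mulVec (u i))
      ≥ x 1 ⬝ᵥ (E 1).mulVec (x 1)) ∧
    (x (n + 1) ⬝ᵥ Q.mulVec (x (n + 1))
      + ∑ i ∈ Finset.Icc 1 n, (x i ⬝ᵥ Q.mulVec (x i) + u i ⬝ᵥ R.mulVec (u i))
      = x 1 ⬝ᵥ (E 1).mulVec (x 1)
      ↔ ∀ i ∈ Finset.Icc 1 n, u i = -((K i).mulVec (x i))) := by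
  have hΨpos : ∀ i ∈ Finset.Icc 1 n, (E (i + 1)).PosSemidef → (ΨL i).PosDef := by
    intro i hi hEi
    rw [hΨL i hi]
    exact posDef_add_transpose_mul_mul hEi hR G
  have hΨt : ∀ i ∈ Finset.Icc 1 n, (E (i + 1)).PosSemidef → (ΨL i)ᵀ = ΨL i := by
    intro i hi hEi
    simpa using (hΨpos i hi hEi).isHermitian.eq
  have hgain : ∀ i ∈ Finset.Icc 1 n, (E (i + 1)).PosSemidef →
      ΨL i * K i = Gᵀ * E (i + 1) * F := by
    intro i hi hEi
    rw [hK i hi, mul_nonsing_inv_cancel_left _ _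
      ((isUnit_iff_isUnit_det _).mp (hΨpos i hi hEi).isUnit)]
  have hEpos : ∀ i ≤ n + 1, 1 ≤ i → (E i).PosSemidef := by
    intro i hi
    induction hi using Nat.decreasingInduction with
    | self => exact fun _ => hEend ▸ hQ
    | of_succ i hi ih =>
      intro h1
      have hmem : i ∈ Finset.Icc 1 n := Finset.mem_Icc.mpr ⟨h1, by lia⟩
      have hnext := ih (by lia)
      rw [hE i hmem]
      exact posSemidef_riccati_update hnext hQ hR.posSemidef (hΨL i hmem) (hΨt i hmem hnext)
        (hgain i hmem hnext)
  have hEnext : ∀ i ∈ Finset.Icc 1 n, (E (i + 1)).PosSemidef := by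
    intro i hi
    have := Finset.mem_Icc.mp hi
    exact hEpos (i + 1) (by lia) (by lia)
  set V : ℕ → ℝ := fun i => x i ⬝ᵥ E i *ᵥ x i with hV
  set gap : ℕ → ℝ := fun i => (u i + K i *ᵥ x i) ⬝ᵥ ΨL i *ᵥ (u i + K i *ᵥ x i) with hgap
  have hstep : ∀ i ∈ Finset.Icc 1 n,
      x i ⬝ᵥ Q *ᵥ x i + u i ⬝ᵥ R *ᵥ u i = gap i - (V (i + 1) - V i) := by
    intro i hi
    have h := riccati_completion_of_squares (Q := Q)
      (by simpa using (hEnext i hi).isHermitian.eq) (hΨL i hi) (hΨt i hi (hEnext i hi))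
      (hgain i hi (hEnext i hi)) (x i) (u i)
    rw [← hx i hi, ← hE i hi] at h
    simp only [hV, hgap]
    linarith
  have htelescope : ∑ i ∈ Finset.Icc 1 n, (V (i + 1) - V i) = V (n + 1) - V 1 := by
    rw [← Finset.Ico_add_one_right_eq_Icc, Finset.sum_Ico_sub V (by lia)]
  have hcost : x (n + 1) ⬝ᵥ Q *ᵥ x (n + 1)
      + ∑ i ∈ Finset.Icc 1 n, (x i ⬝ᵥ Q *ᵥ x i + u i ⬝ᵥ R *ᵥ u i)
      = x 1 ⬝ᵥ E 1 *ᵥ x 1 + ∑ i ∈ Finset.Icc 1 n, gap i := by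
    rw [Finset.sum_congr rfl hstep, Finset.sum_sub_distrib, htelescope]
    simp only [hV, hEend]
    ring
  have hgap_nonneg : ∀ i ∈ Finset.Icc 1 n, 0 ≤ gap i := by
    intro i hi
    have h := (hΨpos i hi (hEnext i hi)).posSemidef.dotProduct_mulVec_nonneg (u i + K i *ᵥ x i)
    rwa [star_trivial] at h
  have hgap_eq_zero : ∀ i ∈ Finset.Icc 1 n, gap i = 0 ↔ u i = -(K i *ᵥ x i) := by
    intro i hi
    rw [← add_eq_zero_iff_eq_neg]
    refine ⟨fun h => ?_, fun h => by simp [hgap, h]⟩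
    by_contra hne
    have hpos := (hΨpos i hi (hEnext i hi)).dotProduct_mulVec_pos hne
    rw [star_trivial] at hpos
    exact hpos.ne' h
  rw [hcost]
  refine ⟨le_add_of_nonneg_right (Finset.sum_nonneg hgap_nonneg), ?_⟩
  rw [add_eq_left, Finset.sum_eq_zero_iff_of_nonneg hgap_nonneg]
  exact forall₂_congr hgap_eq_zero
end

section
/- Let k, m, p, n be positive integers, F a real k×k matrix, G a real k×m matrix, K_p a real k×p matrix, Ψ a symmetric real p×p matrix, Q a symmetric real k×k matrix, and R a symmetric positive definite real m×m matrix. Let E_1, …, E_{n+1} be symmetric real k×k matrices satisfying E_i = Fᵀ E_{i+1} F + Q − K_iᵀ Ψ_{L,i} K_i with Ψ_{L,i} := R + Gᵀ E_{i+1} G and K_i := Ψ_{L,i}⁻¹ Gᵀ E_{i+1} F. Let Σ̂_1, …, Σ̂_{n+1} be real k×k matrices with each Σ̂_i symmetric and invertible, let Γ_1, …, Γ_n be real m×k matrices, M_1, …, M_n real m×m matrices, and let T_1, …, T_n be the real k×k matrices determined by the forward recursion Σ̂_{i+1} = (F + GΓ_iΣ̂_i⁻¹) Σ̂_i (F + GΓ_iΣ̂_i⁻¹)ᵀ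 + G M_i Gᵀ + K_p Ψ K_pᵀ − T_i. Then Σ_{i=1}^n Tr(T_i E_{i+1}) = Σ_{i=1}^n [ Tr(Σ̂_i (K_iᵀ Ψ_{L,i} K_i − Q)) + Tr((M_i + Γ_i Σ̂_i⁻¹ Γ_iᵀ) Gᵀ E_{i+1} G) + Tr(K_p Ψ K_pᵀ E_{i+1}) + 2 Tr(G Γ_i Fᵀ E_{i+1}) ] + Tr(Σ̂_1 E_1) − Tr(Σ̂_{n+1} E_{n+1}). -/
open Matrix

theorem trace_mul_conj_transpose {k m : Type*} [Fintype k] [Fintype m]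
    (E : Matrix k k ℝ) (G : Matrix k m ℝ) (X : Matrix m m ℝ) :
    (G * X * Gᵀ * E).trace = (X * (Gᵀ * E * G)).trace := by
  rw [Matrix.mul_assoc, Matrix.mul_assoc, Matrix.trace_mul_comm]
  simp only [Matrix.mul_assoc]

theorem trace_closedLoop_covariance_mul {k m : Type*} [Fintype k] [DecidableEq k] [Fintype m]
    (F S E : Matrix k k ℝ) (G : Matrix k m ℝ) (Γ : Matrix m k ℝ)
    (hS : Sᵀ = S) (hSdet : IsUnit S.det) (hE : Eᵀ = E) :
    ((F + G * Γ * S⁻¹) * S * (F + G * Γ * S⁻¹)ᵀ * E).trace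
      = (S * (Fᵀ * E * F)).trace + (Γ * S⁻¹ * Γᵀ * (Gᵀ * E * G)).trace
        + 2 * (G * Γ * Fᵀ * E).trace := by
  have hexpand : (F + G * Γ * S⁻¹) * S * (F + G * Γ * S⁻¹)ᵀ
      = F * S * Fᵀ + F * Γᵀ * Gᵀ + G * Γ * Fᵀ + G * (Γ * S⁻¹ * Γᵀ) * Gᵀ := by
    have hleft : (F + G * Γ * S⁻¹) * S = F * S + G * Γ := by
      rw [Matrix.add_mul, Matrix.nonsing_inv_mul_cancel_right _ _ hSdet]
    have hright : (F + G * Γ * S⁻¹)ᵀ = Fᵀ + S⁻¹ * (Γᵀ * Gᵀ) := by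
      rw [transpose_add, transpose_mul, transpose_mul, transpose_nonsing_inv, hS]
    have hcancel : F * S * (S⁻¹ * (Γᵀ * Gᵀ)) = F * Γᵀ * Gᵀ := by
      rw [← Matrix.mul_assoc, Matrix.mul_nonsing_inv_cancel_right _ _ hSdet, Matrix.mul_assoc]
    rw [hleft, hright, Matrix.add_mul, Matrix.mul_add, Matrix.mul_add, hcancel]
    simp only [Matrix.mul_assoc]
    abel
  have hcross : (F * Γᵀ * Gᵀ * E).trace = (G * Γ * Fᵀ * E).trace := by
    rw [← trace_transpose, Matrix.trace_mul_comm (G * Γ * Fᵀ)]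
    simp only [transpose_mul, transpose_transpose, hE, Matrix.mul_assoc]
  rw [hexpand, Matrix.add_mul, Matrix.add_mul, Matrix.add_mul, trace_add, trace_add, trace_add,
    hcross, trace_mul_conj_transpose, trace_mul_conj_transpose]
  ring

theorem sum_Icc_eq_add_sub_of_step {a b f : ℕ → ℝ} {n : ℕ}
    (h : ∀ i ∈ Finset.Icc 1 n, a i = b i + f i - f (i + 1)) :
    ∑ i ∈ Finset.Icc 1 n, a i = ∑ i ∈ Finset.Icc 1 n, b i + f 1 - f (n + 1) := by
  induction n with
  | zero => simp
  | succ n ih =>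
    rw [Finset.sum_Icc_succ_top (by omega), Finset.sum_Icc_succ_top (by omega),
      ih fun i hi => h i (Finset.Icc_subset_Icc_right n.le_succ hi),
      h (n + 1) (by simp)]
    ring

/-- The Kalman-gain term of the observer Riccati recursion, summed against
the LQR matrices `E_{i+1}`, is an affine function of the decision variables
`Σ̂_i, Γ_i, M_i` (eq:KalmanGain_Linear in the proof of Lemma 4). -/
theorem stmt4 (k m p n : ℕ) (hk : 0 < k) (hm : 0 < m) (hp : 0 < p) (hn : 0 < n)
    (F : Matrix (Fin k) (Fin k) ℝ) (G : Matrix (Fin k) (Fin m) ℝ)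
    (Kp : Matrix (Fin k) (Fin p) ℝ) (Ψ : Matrix (Fin p) (Fin p) ℝ)
    (hΨ : Ψ.IsHermitian)
    (Q : Matrix (Fin k) (Fin k) ℝ) (R : Matrix (Fin m) (Fin m) ℝ)
    (hQ : Q.IsHermitian) (hR : R.PosDef)
    (E : ℕ → Matrix (Fin k) (Fin k) ℝ)
    (hEsymm : ∀ i ∈ Finset.Icc 1 (n + 1), (E i).IsHermitian)
    (ΨL : ℕ → Matrix (Fin m) (Fin m) ℝ)
    (K : ℕ → Matrix (Fin m) (Fin k) ℝ)
    (hΨL : ∀ i ∈ Finset.Icc 1 n, ΨL i = R + Gᵀ * E (i + 1) * G)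
    (hK : ∀ i ∈ Finset.Icc 1 n, K i = (ΨL i)⁻¹ * (Gᵀ * E (i + 1) * F))
    (hE : ∀ i ∈ Finset.Icc 1 n,
      E i = Fᵀ * E (i + 1) * F + Q - (K i)ᵀ * ΨL i * K i)
    (Sig : ℕ → Matrix (Fin k) (Fin k) ℝ)
    (hSigSymm : ∀ i ∈ Finset.Icc 1 (n + 1), (Sig i).IsHermitian)
    (hSigInv : ∀ i ∈ Finset.Icc 1 (n + 1), IsUnit (Sig i).det)
    (Γ : ℕ → Matrix (Fin m) (Fin k) ℝ)
    (M : ℕ → Matrix (Fin m) (Fin m) ℝ)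
    (T : ℕ → Matrix (Fin k) (Fin k) ℝ)
    (hT : ∀ i ∈ Finset.Icc 1 n,
      Sig (i + 1)
      = (F + G * Γ i * (Sig i)⁻¹) * Sig i * (F + G * Γ i * (Sig i)⁻¹)ᵀ
        + G * M i * Gᵀ + Kp * Ψ * Kpᵀ - T i) :
    ∑ i ∈ Finset.Icc 1 n, (T i * E (i + 1)).trace
    = ∑ i ∈ Finset.Icc 1 n,
        ((Sig i * ((K i)ᵀ * ΨL i * K i - Q)).trace
          + ((M i + Γ i * (Sig i)⁻¹ * (Γ i)ᵀ) * (Gᵀ * E (i + 1) * G)).trace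
          + (Kp * Ψ * Kpᵀ * E (i + 1)).trace
          + 2 * (G * Γ i * Fᵀ * E (i + 1)).trace)
      + (Sig 1 * E 1).trace - (Sig (n + 1) * E (n + 1)).trace := by
  refine sum_Icc_eq_add_sub_of_step (f := fun i => (Sig i * E i).trace) fun i hi => ?_
  have hi' : i ∈ Finset.Icc 1 (n + 1) := Finset.Icc_subset_Icc_right n.le_succ hi
  have hsucc : i + 1 ∈ Finset.Icc 1 (n + 1) := by
    simp only [Finset.mem_Icc] at hi ⊢
    omega
  have hloop := trace_closedLoop_covariance_mul F (Sig i) (E (i + 1)) G (Γ i)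
    (by simpa using (hSigSymm i hi').eq) (hSigInv i hi') (by simpa using (hEsymm _ hsucc).eq)
  have hcost : (Sig i * (Fᵀ * E (i + 1) * F)).trace
      = (Sig i * E i).trace + (Sig i * ((K i)ᵀ * ΨL i * K i - Q)).trace := by
    rw [← trace_add, ← Matrix.mul_add, hE i hi]
    congr 2
    abel
  have hTi : T i = (F + G * Γ i * (Sig i)⁻¹) * Sig i * (F + G * Γ i * (Sig i)⁻¹)ᵀ
      + G * M i * Gᵀ + Kp * Ψ * Kpᵀ - Sig (i + 1) := by
    rw [hT i hi]
    abel
  rw [hTi, Matrix.sub_mul, Matrix.add_mul, Matrix.add_mul, trace_sub, trace_add, trace_add,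
    hloop, hcost, trace_mul_conj_transpose (E (i + 1)) G (M i), Matrix.add_mul, trace_add]
  ring
end

section
/- Let k, m, p, n be positive integers, F a real k×k matrix, G a real k×m matrix, H a real p×k matrix, J a real p×m matrix, K_p a real k×p matrix, and Ψ a symmetric real p×p matrix. For i = 1, …, n let Π_i be a symmetric real m×m matrix, Γ_i a real m×k matrix, and let Σ̂_1, …, Σ̂_{n+1} be symmetric real k×k matrices with Σ̂_1 = 0 and Σ̂_{n+1} positive semidefinite. Define Ψ_{Y,i} := J Π_i Jᵀ + H Σ̂_i Hᵀ + H Γ_iᵀ Jᵀ + J Γ_i Hᵀ + Ψ and S_i := F Γ_iᵀ Jᵀ + F Σ̂_i Hᵀ + G Π_i Jᵀ + G Γ_i Hᵀ + K_p Ψ, and suppose that for each i the (k+p)×(k+p) block matrix B_i := [[F Σ̂_i Fᵀ + F Γ_iᵀ Gᵀ + G Γ_i Fᵀ + G Π_i Gᵀ + K_p Ψ K_pᵀ − Σ̂_{i+1}, S_i],[S_iᵀ, Ψ_{Y,i}]] is positive semidefinite. Let Π̄, Γ̄, Σ̂̄ denote the averages (1/n)Σ_{i=1}^n of Π_i, Γ_i,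 Σ̂_i respectively, and define Ψ̄_Y and S̄ by the same expressions with (Π̄, Γ̄, Σ̂̄) in place of (Π_i, Γ_i, Σ̂_i). Then the block matrix B̄ := [[F Σ̂̄ Fᵀ + F Γ̄ᵀ Gᵀ + G Γ̄ Fᵀ + G Π̄ Gᵀ + K_p Ψ K_pᵀ − Σ̂̄, S̄],[S̄ᵀ, Ψ̄_Y]] is positive semidefinite. -/
open Matrix

theorem Matrix.PosSemidef.fromBlocks_zero {k p : Type*} [Finite k] [Finite p]
    {A : Matrix k k ℝ} (hA : A.PosSemidef) :
    (fromBlocks A 0 0 (0 : Matrix p p ℝ)).PosSemidef := by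
  classical
  have := Fintype.ofFinite k
  have := Fintype.ofFinite p
  have h := hA.mul_mul_conjTranspose_same (fromRows (1 : Matrix k k ℝ) (0 : Matrix p k ℝ))
  convert h using 1
  rw [conjTranspose_fromRows_eq_fromCols_conjTranspose, fromRows_mul, fromRows_mul_fromCols]
  simp

theorem Matrix.sum_fromBlocks {ι k l p q α : Type*} [AddCommMonoid α] (s : Finset ι)
    (A : ι → Matrix k p α) (B : ι → Matrix k q α) (C : ι → Matrix l p α)
    (D : ι → Matrix l q α) :
    ∑ i ∈ s, fromBlocks (A i) (B i) (C i) (D i)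
      = fromBlocks (∑ i ∈ s, A i) (∑ i ∈ s, B i) (∑ i ∈ s, C i) (∑ i ∈ s, D i) := by
  ext (i | i) (j | j) <;> simp [Matrix.sum_apply]

/-- Averaging step (eq:riccati_convex) of Theorem 1: the per-time Riccati
LMI constraints together with `Σ̂_1 = 0` and `Σ̂_{n+1} ⪰ 0` imply the
single-letter Riccati LMI at the averaged decision variables. -/
theorem stmt7 (k m p n : ℕ) (hk : 0 < k) (hm : 0 < m) (hp : 0 < p) (hn : 0 < n)
    (F : Matrix (Fin k) (Fin k) ℝ) (G : Matrix (Fin k) (Fin m) ℝ)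
    (H : Matrix (Fin p) (Fin k) ℝ) (J : Matrix (Fin p) (Fin m) ℝ)
    (Kp : Matrix (Fin k) (Fin p) ℝ) (Ψ : Matrix (Fin p) (Fin p) ℝ)
    (hΨ : Ψ.IsHermitian)
    (Pim : ℕ → Matrix (Fin m) (Fin m) ℝ)
    (hPim : ∀ i ∈ Finset.Icc 1 n, (Pim i).IsHermitian)
    (Γ : ℕ → Matrix (Fin m) (Fin k) ℝ)
    (Sig : ℕ → Matrix (Fin k) (Fin k) ℝ)
    (hSig : ∀ i ∈ Finset.Icc 1 (n + 1), (Sig i).IsHermitian)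
    (hSig1 : Sig 1 = 0) (hSigEnd : (Sig (n + 1)).PosSemidef)
    (ΨY : ℕ → Matrix (Fin p) (Fin p) ℝ)
    (hΨY : ∀ i ∈ Finset.Icc 1 n, ΨY i
      = J * Pim i * Jᵀ + H * Sig i * Hᵀ + H * (Γ i)ᵀ * Jᵀ + J * Γ i * Hᵀ + Ψ)
    (S : ℕ → Matrix (Fin k) (Fin p) ℝ)
    (hS : ∀ i ∈ Finset.Icc 1 n, S i
      = F * (Γ i)ᵀ * Jᵀ + F * Sig i * Hᵀ + G * Pim i * Jᵀ + G * Γ i * Hᵀ + Kp * Ψ)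
    (hB : ∀ i ∈ Finset.Icc 1 n,
      (Matrix.fromBlocks
        (F * Sig i * Fᵀ + F * (Γ i)ᵀ * Gᵀ + G * Γ i * Fᵀ + G * Pim i * Gᵀ
          + Kp * Ψ * Kpᵀ - Sig (i + 1))
        (S i) (S i)ᵀ (ΨY i)).PosSemidef)
    (Pb : Matrix (Fin m) (Fin m) ℝ)
    (hPb : Pb = ((n : ℝ)⁻¹) • ∑ i ∈ Finset.Icc 1 n, Pim i)
    (Γb : Matrix (Fin m) (Fin k) ℝ)
    (hΓb : Γb = ((n : ℝ)⁻¹) • ∑ i ∈ Finset.Icc 1 n, Γ i)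
    (Sb : Matrix (Fin k) (Fin k) ℝ)
    (hSb : Sb = ((n : ℝ)⁻¹) • ∑ i ∈ Finset.Icc 1 n, Sig i)
    (ΨYb : Matrix (Fin p) (Fin p) ℝ)
    (hΨYb : ΨYb = J * Pb * Jᵀ + H * Sb * Hᵀ + H * Γbᵀ * Jᵀ + J * Γb * Hᵀ + Ψ)
    (Sbb : Matrix (Fin k) (Fin p) ℝ)
    (hSbb : Sbb = F * Γbᵀ * Jᵀ + F * Sb * Hᵀ + G * Pb * Jᵀ + G * Γb * Hᵀ + Kp * Ψ) :
    (Matrix.fromBlocks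
      (F * Sb * Fᵀ + F * Γbᵀ * Gᵀ + G * Γb * Fᵀ + G * Pb * Gᵀ
        + Kp * Ψ * Kpᵀ - Sb)
      Sbb Sbbᵀ ΨYb).PosSemidef := by
  have hn0 : (n : ℝ) ≠ 0 := Nat.cast_ne_zero.mpr hn.ne'
  have hconst {a b : ℕ} (X : Matrix (Fin a) (Fin b) ℝ) :
      (n : ℝ)⁻¹ • ∑ _i ∈ Finset.Icc 1 n, X = X := by
    rw [Finset.sum_const, Nat.card_Icc, Nat.add_sub_cancel, ← Nat.cast_smul_eq_nsmul ℝ,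
      inv_smul_smul₀ hn0]
  have htel : ∑ i ∈ Finset.Icc 1 n, Sig (i + 1) - Sig (n + 1)
      = ∑ i ∈ Finset.Icc 1 n, Sig i := by
    have h := Finset.sum_Ico_sub Sig (show 1 ≤ n + 1 by lia)
    rw [Finset.Ico_add_one_right_eq_Icc, Finset.sum_sub_distrib, hSig1, sub_zero] at h
    rw [← h]
    abel
  have hΨYavg : (n : ℝ)⁻¹ • ∑ i ∈ Finset.Icc 1 n, ΨY i = ΨYb := by
    rw [Finset.sum_congr rfl hΨY, hΨYb, hPb, hSb, hΓb]
    simp only [Finset.sum_add_distrib, smul_add, hconst, Matrix.mul_smul, Matrix.smul_mul,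
      Matrix.mul_sum, Matrix.sum_mul, transpose_smul, transpose_sum]
  have hSavg : (n : ℝ)⁻¹ • ∑ i ∈ Finset.Icc 1 n, S i = Sbb := by
    rw [Finset.sum_congr rfl hS, hSbb, hPb, hSb, hΓb]
    simp only [Finset.sum_add_distrib, smul_add, hconst, Matrix.mul_smul, Matrix.smul_mul,
      Matrix.mul_sum, Matrix.sum_mul, transpose_smul, transpose_sum]
  have h := ((posSemidef_sum (Finset.Icc 1 n) hB).add
    (hSigEnd.fromBlocks_zero (p := Fin p))).smul (inv_nonneg.mpr (Nat.cast_nonneg (α := ℝ) n))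
  rw [sum_fromBlocks, fromBlocks_add, fromBlocks_smul] at h
  simp only [add_zero, ← transpose_sum, ← transpose_smul, hSavg, hΨYavg] at h
  convert h using 2
  rw [Finset.sum_sub_distrib, sub_add, htel, hPb, hSb, hΓb]
  simp only [Finset.sum_add_distrib, smul_add, smul_sub, hconst, Matrix.mul_smul,
    Matrix.smul_mul, Matrix.mul_sum, Matrix.sum_mul, transpose_smul, transpose_sum]
end

section
/- Let k, m, p be positive integers, F a real k×k matrix, G a real k×m matrix, H a real p×k matrix, J a real p×m matrix, K_p a real k×p matrix, and Ψ a symmetric real p×p matrix. Let Σ̂* be a symmetric invertible real k×k matrix, Γ* a real m×k matrix, and Π* a symmetric real m×m matrix. Define Γ̄ := Γ* Σ̂*⁻¹ and M := Π* − Γ* Σ̂*⁻¹ Γ*ᵀ, and define Ψ_Y* := J Π* Jᵀ + H Σ̂* Hᵀ + H Γ*ᵀ Jᵀ + J Γ* Hᵀ + Ψ, assumed invertible, and K_Y* := (F Γ*ᵀ Jᵀ + F Σ̂* Hᵀ + G Π* Jᵀ + G Γ* Hᵀ + K_p Ψ) (Ψ_Y*)⁻¹. Then: (i) (H + JΓ̄)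 Σ̂* (H + JΓ̄)ᵀ + J M Jᵀ + Ψ = Ψ_Y*; (ii) ((F + GΓ̄) Σ̂* (H + JΓ̄)ᵀ + G M Jᵀ + K_p Ψ)(Ψ_Y*)⁻¹ = K_Y*; and (iii) if moreover Σ̂* = F Σ̂* Fᵀ + F Γ*ᵀ Gᵀ + G Γ* Fᵀ + G Π* Gᵀ + K_p Ψ K_pᵀ − K_Y* Ψ_Y* (K_Y*)ᵀ, then Σ̂* = (F + GΓ̄) Σ̂* (F + GΓ̄)ᵀ + G M Gᵀ + K_p Ψ K_pᵀ − K_Y* Ψ_Y* (K_Y*)ᵀ, i.e., Σ̂* is a fixed point of the Riccati map associated with the time-invariant policy with parameters (Γ̄, M). -/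
open Matrix

/-- Completing the square: the substitution `X ↦ Γ * S⁻¹`, with the Schur complement of `S` as
residual covariance, reproduces the joint second-moment form. -/
theorem add_mul_inv_sandwich_add_schur {R a b k m : Type*} [CommRing R]
    [Fintype k] [DecidableEq k] [Fintype m]
    (A : Matrix a k R) (B : Matrix a m R) (C : Matrix b k R) (D : Matrix b m R)
    {S : Matrix k k R} (hS : S.IsSymm) (hdet : IsUnit S.det)
    (Γ : Matrix m k R) (P : Matrix m m R) :
    (A + B * (Γ * S⁻¹)) * S * (C + D * (Γ * S⁻¹))ᵀ + B * (P - Γ * S⁻¹ * Γᵀ) * Dᵀ =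
      A * S * Cᵀ + A * Γᵀ * Dᵀ + B * Γ * Cᵀ + B * P * Dᵀ := by
  have hl : (A + B * (Γ * S⁻¹)) * S = A * S + B * Γ := by
    rw [Matrix.add_mul, ← Matrix.mul_assoc, Matrix.nonsing_inv_mul_cancel_right _ _ hdet]
  have hr : (C + D * (Γ * S⁻¹))ᵀ = Cᵀ + S⁻¹ * Γᵀ * Dᵀ := by
    rw [transpose_add, transpose_mul, transpose_mul, transpose_nonsing_inv, hS.eq]
  rw [hl, hr]
  simp only [Matrix.add_mul, Matrix.mul_add, Matrix.mul_sub, Matrix.sub_mul, Matrix.mul_assoc,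
    Matrix.mul_nonsing_inv_cancel_left _ _ hdet]
  abel

/-- Algebraic core of Theorem 2: with `Γ̄ = Γ* Σ̂*⁻¹`, `M = Π* − Γ* Σ̂*⁻¹ Γ*ᵀ`,
the policy innovation covariance and Kalman gain coincide with `Ψ_Y*`, `K_Y*`,
and if `Σ̂*` satisfies the Riccati equation of the upper bound then it is a
fixed point of the Riccati map of the time-invariant policy `(Γ̄, M)`. -/
theorem stmt9 (k m p : ℕ) (hk : 0 < k) (hm : 0 < m) (hp : 0 < p)
    (F : Matrix (Fin k) (Fin k) ℝ) (G : Matrix (Fin k) (Fin m) ℝ)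
    (H : Matrix (Fin p) (Fin k) ℝ) (J : Matrix (Fin p) (Fin m) ℝ)
    (Kp : Matrix (Fin k) (Fin p) ℝ) (Ψ : Matrix (Fin p) (Fin p) ℝ)
    (hΨ : Ψ.IsHermitian)
    (Sig : Matrix (Fin k) (Fin k) ℝ) (hSig : Sig.IsHermitian)
    (hSigInv : IsUnit Sig.det)
    (Γ : Matrix (Fin m) (Fin k) ℝ)
    (Pim : Matrix (Fin m) (Fin m) ℝ) (hPim : Pim.IsHermitian)
    (Γb : Matrix (Fin m) (Fin k) ℝ) (hΓb : Γb = Γ * Sig⁻¹)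
    (M : Matrix (Fin m) (Fin m) ℝ) (hM : M = Pim - Γ * Sig⁻¹ * Γᵀ)
    (ΨY : Matrix (Fin p) (Fin p) ℝ)
    (hΨY : ΨY = J * Pim * Jᵀ + H * Sig * Hᵀ + H * Γᵀ * Jᵀ + J * Γ * Hᵀ + Ψ)
    (hΨYInv : IsUnit ΨY.det)
    (KY : Matrix (Fin k) (Fin p) ℝ)
    (hKY : KY = (F * Γᵀ * Jᵀ + F * Sig * Hᵀ + G * Pim * Jᵀ + G * Γ * Hᵀ + Kp * Ψ)
      * ΨY⁻¹) :
    ((H + J * Γb) * Sig * (H + J * Γb)ᵀ + J * M * Jᵀ + Ψ = ΨY) ∧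
    (((F + G * Γb) * Sig * (H + J * Γb)ᵀ + G * M * Jᵀ + Kp * Ψ) * ΨY⁻¹ = KY) ∧
    (Sig = F * Sig * Fᵀ + F * Γᵀ * Gᵀ + G * Γ * Fᵀ + G * Pim * Gᵀ
        + Kp * Ψ * Kpᵀ - KY * ΨY * KYᵀ →
      Sig = (F + G * Γb) * Sig * (F + G * Γb)ᵀ + G * M * Gᵀ
        + Kp * Ψ * Kpᵀ - KY * ΨY * KYᵀ) := by
  have hS : Sig.IsSymm := (conjTranspose_eq_transpose_of_trivial Sig).symm.trans hSig
  subst hΓb hM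
  refine ⟨?_, ?_, fun h => ?_⟩
  · rw [add_mul_inv_sandwich_add_schur H J H J hS hSigInv, hΨY]
    abel
  · rw [add_mul_inv_sandwich_add_schur F G H J hS hSigInv, hKY]
    congr 1
    abel
  · rwa [add_mul_inv_sandwich_add_schur F G F G hS hSigInv]
end

section
/- Let a, h, Ψ be real numbers with h ≠ 0, Ψ > 0, and a² > 1, define g(x) := a²·Ψ·x/(h²·x + Ψ) and x* := Ψ·(a² − 1)/h². Then for every x₁ > 0, the sequence defined by x_{n+1} := g(x_n) converges to x* as n → ∞. -/
/-- In the coordinate `x⁻¹` the scalar Riccati map is affine, with slope `(a²)⁻¹` and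
fixed point `(Ψ(a²−1)/h²)⁻¹`. -/
lemma inv_riccati_sub_inv_fixedPoint {a h Ψ x : ℝ} (hh : h ≠ 0) (hΨ : 0 < Ψ)
    (ha : 1 < a ^ 2) (hx : 0 < x) :
    (a ^ 2 * Ψ * x / (h ^ 2 * x + Ψ))⁻¹ - (Ψ * (a ^ 2 - 1) / h ^ 2)⁻¹ =
      (a ^ 2)⁻¹ * (x⁻¹ - (Ψ * (a ^ 2 - 1) / h ^ 2)⁻¹) := by
  have ha' : a ^ 2 - 1 ≠ 0 := by linarith
  have ha0 : a ≠ 0 := by rintro rfl; norm_num at ha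
  have hden : h ^ 2 * x + Ψ ≠ 0 := by positivity
  field_simp
  ring

/-- Convergence of the scalar Riccati recursion
`x_{n+1} = g(x_n)`, `g(x) = a²Ψx/(h²x + Ψ)`, from any strictly positive
initialization to the maximal fixed point `x* = Ψ(a²−1)/h²`. -/
theorem stmt15 (a h Ψ : ℝ) (hh : h ≠ 0) (hΨ : 0 < Ψ) (ha : 1 < a ^ 2)
    (g : ℝ → ℝ) (hg : ∀ x, g x = a ^ 2 * Ψ * x / (h ^ 2 * x + Ψ))
    (xstar : ℝ) (hxstar : xstar = Ψ * (a ^ 2 - 1) / h ^ 2) :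
    ∀ x₁ : ℝ, 0 < x₁ →
      Filter.Tendsto (fun n : ℕ => g^[n] x₁) Filter.atTop (nhds xstar) := by
  intro x₁ hx₁
  have hstar : 0 < xstar := by
    rw [hxstar]
    have : 0 < a ^ 2 - 1 := by linarith
    positivity
  have hpos (n : ℕ) : 0 < g^[n] x₁ := by
    induction n with
    | zero => exact hx₁
    | succ n ih =>
      rw [Function.iterate_succ_apply', hg]
      have : 0 < a ^ 2 := by linarith
      positivity
  have hinv (n : ℕ) :
      (g^[n] x₁)⁻¹ = ((a ^ 2)⁻¹) ^ n * (x₁⁻¹ - xstar⁻¹) + xstar⁻¹ := by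
    induction n with
    | zero => simp
    | succ n ih =>
      have hstep := inv_riccati_sub_inv_fixedPoint hh hΨ ha (hpos n)
      rw [← hg, ← hxstar, ih] at hstep
      rw [Function.iterate_succ_apply']
      linear_combination hstep
  have hlim : Filter.Tendsto (fun n : ℕ => (g^[n] x₁)⁻¹) Filter.atTop (nhds xstar⁻¹) := by
    simp only [hinv]
    simpa using ((tendsto_pow_atTop_nhds_zero_of_lt_one (by positivity)
      (inv_lt_one_of_one_lt₀ ha)).mul_const (x₁⁻¹ - xstar⁻¹)).add_const xstar⁻¹
  simpa using hlim.inv₀ (inv_ne_zero hstar.ne')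
end
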